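/- Let A = [a_{ij}] ∈ ℝ^{N×N} be the adjacency matrix of a weighted directed graph and L = D_in − A its Laplacian. If the graph is strongly connected (for every ordered pair of distinct vertices (i,j) there is a directed path from i to j along edges of positive weight), then zero is a simple eigenvalue of L; that is, the multiplicity of 0 as a root of the characteristic polynomial of L equals 1. -/

import Mathlib

open Matrix

/-- The Laplacian `L = D_in − A` of a weighted directed graph with adjacency matrix `A`. -/
noncomputable def graphLaplacian {N : ℕ} (A : Matrix (Fin N) (Fin N) ℝ) :
    Matrix (Fin N) (Fin N) ℝ :=
  Matrix.of fun i j => (if i = j then ∑ k, A i k else 0) - A i j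

theorem graphLaplacian_mulVec_apply {N : ℕ} (A : Matrix (Fin N) (Fin N) ℝ) (x : Fin N → ℝ)
    (i : Fin N) : (graphLaplacian A *ᵥ x) i = ∑ j, A i j * (x i - x j) := by
  simp [graphLaplacian, mulVec, dotProduct, sub_mul, mul_sub, Finset.sum_sub_distrib,
    Finset.sum_mul]

/-- At a maximum of `x` the Laplacian of `x` is nonnegative. -/
theorem graphLaplacian_mulVec_nonneg_of_isMax {N : ℕ} {A : Matrix (Fin N) (Fin N) ℝ}
    (hA : ∀ i j, 0 ≤ A i j) {x : Fin N → ℝ} {i : Fin N} (hi : ∀ j, x j ≤ x i) :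
    0 ≤ (graphLaplacian A *ᵥ x) i := by
  rw [graphLaplacian_mulVec_apply]
  exact Finset.sum_nonneg fun j _ => mul_nonneg (hA i j) (sub_nonneg.2 (hi j))

/-- Maximum principle: a vector in the kernel of the Laplacian of a strongly connected graph is
constant. -/
theorem eq_of_graphLaplacian_mulVec_eq_zero {N : ℕ} {A : Matrix (Fin N) (Fin N) ℝ}
    (hA : ∀ i j, 0 ≤ A i j)
    (hconn : ∀ i j : Fin N, i ≠ j → Relation.TransGen (fun u v : Fin N => 0 < A v u) i j)
    {x : Fin N → ℝ} (hx : graphLaplacian A *ᵥ x = 0) (i j : Fin N) : x i = x j := by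
  have : Nonempty (Fin N) := ⟨i⟩
  obtain ⟨m, hm⟩ := Finite.exists_max x
  have step : ∀ u v, 0 < A v u → x v = x m → x u = x m := by
    intro u v huv hv
    have h0 : ∑ k, A v k * (x v - x k) = 0 := by
      rw [← graphLaplacian_mulVec_apply, hx, Pi.zero_apply]
    rw [Finset.sum_eq_zero_iff_of_nonneg fun k _ =>
      mul_nonneg (hA v k) (sub_nonneg.2 (hv ▸ hm k))] at h0
    rcases mul_eq_zero.1 (h0 u (Finset.mem_univ u)) with h | h
    · exact absurd h huv.ne'
    · linarith
  have key : ∀ k, x k = x m := by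
    intro k
    by_cases hk : k = m
    · rw [hk]
    · induction hconn k m hk using Relation.TransGen.head_induction_on with
      | single h => exact step _ _ h rfl
      | @head a c h _ ih =>
        refine step _ _ h ?_
        by_cases hc : c = m
        · rw [hc]
        · exact ih hc
  rw [key i, key j]

/-- The Laplacian of a strongly connected graph has no Jordan chain of length two at `0`. -/
theorem graphLaplacian_mulVec_eq_zero_of_sq {N : ℕ} {A : Matrix (Fin N) (Fin N) ℝ}
    (hA : ∀ i j, 0 ≤ A i j)
    (hconn : ∀ i j : Fin N, i ≠ j → Relation.TransGen (fun u v : Fin N => 0 < A v u) i j)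
    {x : Fin N → ℝ} (hx : graphLaplacian A *ᵥ (graphLaplacian A *ᵥ x) = 0) :
    graphLaplacian A *ᵥ x = 0 := by
  have hc := eq_of_graphLaplacian_mulVec_eq_zero hA hconn hx
  ext i
  have : Nonempty (Fin N) := ⟨i⟩
  obtain ⟨m, hm⟩ := Finite.exists_max x
  obtain ⟨l, hl⟩ := Finite.exists_min x
  have h1 := graphLaplacian_mulVec_nonneg_of_isMax hA hm
  have h2 := graphLaplacian_mulVec_nonneg_of_isMax (x := -x) hA fun j => neg_le_neg (hl j)
  rw [mulVec_neg, Pi.neg_apply, hc l i] at h2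
  rw [hc m i] at h1
  exact le_antisymm (neg_nonneg.1 h2) h1

/-- If a weighted directed graph (adjacency matrix `A`, nonnegative weights, zero diagonal;
an edge from `j` to `i` iff `A i j > 0`) is strongly connected — i.e. for every ordered
pair of distinct vertices `(i, j)` there is a directed path from `i` to `j` along edges of
positive weight — then `0` is a simple eigenvalue of the Laplacian `L = D_in − A`:
the multiplicity of `0` as a root of the characteristic polynomial of `L` equals `1`. -/
theorem laplacian_zero_simple_eigenvalue {N : ℕ} (hN : 0 < N)
    (A : Matrix (Fin N) (Fin N) ℝ)
    (hA_nonneg : ∀ i j, 0 ≤ A i j) (hA_diag : ∀ i, A i i = 0)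
    (hconn : ∀ i j : Fin N, i ≠ j →
      Relation.TransGen (fun u v : Fin N => 0 < A v u) i j) :
    ((graphLaplacian A).charpoly).rootMultiplicity 0 = 1 := by
  rw [← Matrix.charpoly_toLin', ← LinearMap.finrank_maxGenEigenspace_eq]
  have hspan : Module.End.maxGenEigenspace (Matrix.toLin' (graphLaplacian A)) 0 =
      ℝ ∙ (1 : Fin N → ℝ) := by
    ext x
    rw [Module.End.mem_maxGenEigenspace, Submodule.mem_span_singleton]
    simp only [zero_smul, sub_zero]
    constructor
    · rintro ⟨k, hk⟩
      have hx : graphLaplacian A *ᵥ x = 0 := by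
        induction k generalizing x with
        | zero => rw [show x = 0 by simpa using hk, mulVec_zero]
        | succ k ih =>
          rw [pow_succ, Module.End.mul_apply, toLin'_apply] at hk
          exact graphLaplacian_mulVec_eq_zero_of_sq hA_nonneg hconn (ih _ hk)
      refine ⟨x ⟨0, hN⟩, ?_⟩
      ext i
      simpa using eq_of_graphLaplacian_mulVec_eq_zero hA_nonneg hconn hx ⟨0, hN⟩ i
    · rintro ⟨c, rfl⟩
      refine ⟨1, ?_⟩
      rw [pow_one, toLin'_apply]
      ext i
      simp [graphLaplacian_mulVec_apply]
  rw [hspan]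
  have : Nonempty (Fin N) := ⟨⟨0, hN⟩⟩
  exact finrank_span_singleton one_ne_zero
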